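/- For a bounded operator A on a complex Hilbert space define g(A) as the infimum of the spectrum of the positive operator (1 + A*A)^{-1/2}(1 − A)*(1 − A)(1 + A*A)^{-1/2}. Then for every J-unitary operator T on K one has g(V(T)) = g(T) and g(T) = g(T*) = g(T^{-1}). -/

import Mathlib

noncomputable section

open ContinuousLinearMap

variable {H : Type*} [NormedAddCommGroup H] [InnerProductSpace ℂ H] [CompleteSpace H]
  [TopologicalSpace.SeparableSpace H]

local notation "K" => WithLp 2 (H × H)

/-- The 2×2 block operator `[[a,b],[c,d]]` on `K = H ⊕ H`. -/
def blk (a b c d : H →L[ℂ] H) : K →L[ℂ] K :=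
  (((WithLp.prodContinuousLinearEquiv 2 ℂ H H).symm : (H × H) →L[ℂ] K).comp
      ((((a.comp (fst ℂ H H)) + (b.comp (snd ℂ H H))).prod
        ((c.comp (fst ℂ H H)) + (d.comp (snd ℂ H H)))))).comp
    ((WithLp.prodContinuousLinearEquiv 2 ℂ H H : K →L[ℂ] (H × H)))

/-- The fundamental symmetry `J = [[1,0],[0,-1]]`. -/
def fundJ : K →L[ℂ] K := blk 1 0 0 (-1)

/-- A bounded operator `T` on the Krein space `(K, J)` is `J`-unitary if it is invertible
and `T* J T = J`. -/
def IsJUnitary (T : K →L[ℂ] K) : Prop :=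
  IsUnit T ∧ star T * fundJ * T = fundJ

/-- Embedding of `H` into the first summand of `K = H ⊕ H`. -/
def embFst : H →L[ℂ] K :=
  ((WithLp.prodContinuousLinearEquiv 2 ℂ H H).symm : (H × H) →L[ℂ] K).comp (inl ℂ H H)

/-- Embedding of `H` into the second summand of `K = H ⊕ H`. -/
def embSnd : H →L[ℂ] K :=
  ((WithLp.prodContinuousLinearEquiv 2 ℂ H H).symm : (H × H) →L[ℂ] K).comp (inr ℂ H H)

/-- Projection onto the first summand of `K = H ⊕ H`. -/
def projFst : K →L[ℂ] H :=
  (fst ℂ H H).comp ((WithLp.prodContinuousLinearEquiv 2 ℂ H H : K →L[ℂ] (H × H)))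

/-- Projection onto the second summand of `K = H ⊕ H`. -/
def projSnd : K →L[ℂ] H :=
  (snd ℂ H H).comp ((WithLp.prodContinuousLinearEquiv 2 ℂ H H : K →L[ℂ] (H × H)))

/-- The four blocks of an operator on `K = H ⊕ H`. -/
def blkA (T : K →L[ℂ] K) : H →L[ℂ] H := projFst ∘L (T ∘L embFst)
def blkB (T : K →L[ℂ] K) : H →L[ℂ] H := projFst ∘L (T ∘L embSnd)
def blkC (T : K →L[ℂ] K) : H →L[ℂ] H := projSnd ∘L (T ∘L embFst)
def blkD (T : K →L[ℂ] K) : H →L[ℂ] H := projSnd ∘L (T ∘L embSnd)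

/-- The unitary `V(T) = [[(a*)⁻¹, bd⁻¹],[−d⁻¹c, d⁻¹]]` associated to a `J`-unitary
`T = [[a,b],[c,d]]`. -/
def Vop (T : K →L[ℂ] K) : K →L[ℂ] K :=
  blk (Ring.inverse (star (blkA T))) (blkB T * Ring.inverse (blkD T))
    (-(Ring.inverse (blkD T) * blkC T)) (Ring.inverse (blkD T))

/-- The gap `g(A)`: the infimum of the spectrum of the positive operator
`(1 + A*A)^{-1/2} (1 − A)* (1 − A) (1 + A*A)^{-1/2}`. -/
def gapAt1 {E : Type*} [NormedAddCommGroup E] [InnerProductSpace ℂ E] [CompleteSpace E]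
    (A : E →L[ℂ] E) : ℝ :=
  sInf (spectrum ℝ
    (Ring.inverse (CFC.sqrt (1 + star A * A)) * (star (1 - A) * (1 - A))
      * Ring.inverse (CFC.sqrt (1 + star A * A))))

set_option linter.unusedSectionVars false

section Gap

variable {E : Type*} [NormedAddCommGroup E] [InnerProductSpace ℂ E] [CompleteSpace E]

lemma isStrictlyPositive_one_add_star_mul_self (A : E →L[ℂ] E) :
    IsStrictlyPositive (1 + star A * A) :=
  isStrictlyPositive_one.add_nonneg (star_mul_self_nonneg A)

/-- A lower bound for the spectrum defining `gapAt1 A` is a lower bound for a quotient of norms. -/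
lemma mem_lowerBounds_spectrum_iff (A : E →L[ℂ] E) (c : ℝ) :
    c ∈ lowerBounds (spectrum ℝ
      (Ring.inverse (CFC.sqrt (1 + star A * A)) * (star (1 - A) * (1 - A))
        * Ring.inverse (CFC.sqrt (1 + star A * A)))) ↔
    ∀ x, c * (‖x‖ ^ 2 + ‖A x‖ ^ 2) ≤ ‖x - A x‖ ^ 2 := by
  have hpos := isStrictlyPositive_one_add_star_mul_self A
  set S := CFC.sqrt (1 + star A * A)
  have hSS : S * S = 1 + star A * A := CFC.sqrt_mul_sqrt_self _ hpos.nonneg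
  have hSu : IsUnit S := (CFC.isUnit_sqrt_iff _ hpos.nonneg).2 hpos.isUnit
  have hSsa : IsSelfAdjoint S := (CFC.sqrt_nonneg _).isSelfAdjoint
  set R := Ring.inverse S with hR
  have hRsa : IsSelfAdjoint R := by
    rw [isSelfAdjoint_iff, hR, ← Ring.inverse_star, hSsa.star_eq]
  have hSR : S * R = 1 := Ring.mul_inverse_cancel S hSu
  have hRS : R * S = 1 := Ring.inverse_mul_cancel S hSu
  have hX : IsSelfAdjoint (R * (star (1 - A) * (1 - A)) * R) := by
    simpa only [hRsa.star_eq] using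
      (IsSelfAdjoint.star_mul_self (1 - A)).conjugate R
  have key : algebraMap ℝ (E →L[ℂ] E) c ≤ R * (star (1 - A) * (1 - A)) * R ↔
      c • (1 + star A * A) ≤ star (1 - A) * (1 - A) := by
    constructor
    · intro h
      have h' := IsSelfAdjoint.conjugate_le_conjugate h hSsa
      have e : S * (R * (star (1 - A) * (1 - A)) * R) * S = star (1 - A) * (1 - A) := by
        calc _ = (S * R) * (star (1 - A) * (1 - A)) * (R * S) := by simp only [mul_assoc]
          _ = _ := by rw [hSR, hRS, one_mul, mul_one]
      rwa [e, Algebra.algebraMap_eq_smul_one, mul_smul_comm, mul_one, smul_mul_assoc, hSS] at h'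
    · intro h
      have h' := IsSelfAdjoint.conjugate_le_conjugate h hRsa
      have e : R * (c • (S * S)) * R = algebraMap ℝ (E →L[ℂ] E) c := by
        calc _ = c • ((R * S) * (S * R)) := by
              simp only [mul_assoc, mul_smul_comm, smul_mul_assoc]
          _ = _ := by rw [hSR, hRS, one_mul, Algebra.algebraMap_eq_smul_one]
      rwa [← hSS, e] at h'
  have hlb : c ∈ lowerBounds (spectrum ℝ (R * (star (1 - A) * (1 - A)) * R)) ↔
      algebraMap ℝ (E →L[ℂ] E) c ≤ R * (star (1 - A) * (1 - A)) * R :=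
    (algebraMap_le_iff_le_spectrum hX).symm
  rw [hlb, key, ContinuousLinearMap.le_def, ContinuousLinearMap.isPositive_def']
  have hsa : IsSelfAdjoint (star (1 - A) * (1 - A) - c • (1 + star A * A)) :=
    (IsSelfAdjoint.star_mul_self _).sub
      ((IsSelfAdjoint.all c).smul hpos.nonneg.isSelfAdjoint)
  rw [and_iff_right hsa]
  refine forall_congr' fun x => ?_
  have e : (star (1 - A) * (1 - A) - c • (1 + star A * A)).reApplyInnerSelf x =
      ‖x - A x‖ ^ 2 - c * (‖x‖ ^ 2 + ‖A x‖ ^ 2) := by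
    have h1 (B : E →L[ℂ] E) : RCLike.re (inner ℂ ((star B * B) x) x) = ‖B x‖ ^ 2 :=
      (apply_norm_sq_eq_inner_adjoint_left B x).symm
    have h2 : RCLike.re (inner ℂ ((c • (1 + star A * A)) x) x) =
        c * (‖x‖ ^ 2 + ‖A x‖ ^ 2) := by
      rw [smul_apply, ← Complex.coe_smul, inner_smul_left,
        add_apply, inner_add_left, ← h1 A, ← inner_self_eq_norm_sq (𝕜 := ℂ) x]
      simp
    rw [ContinuousLinearMap.reApplyInnerSelf_apply, sub_apply, inner_sub_left,
      map_sub, h1, h2]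
    rfl
  rw [e, sub_nonneg]

lemma gapAt1_eq_sSup (A : E →L[ℂ] E) [Nontrivial E] :
    gapAt1 A = sSup {c : ℝ | ∀ x, c * (‖x‖ ^ 2 + ‖A x‖ ^ 2) ≤ ‖x - A x‖ ^ 2} := by
  have hsa : IsSelfAdjoint (Ring.inverse (CFC.sqrt (1 + star A * A)) *
      (star (1 - A) * (1 - A)) * Ring.inverse (CFC.sqrt (1 + star A * A))) := by
    have hR : IsSelfAdjoint (Ring.inverse (CFC.sqrt (1 + star A * A))) := by
      rw [isSelfAdjoint_iff, ← Ring.inverse_star, (CFC.sqrt_nonneg _).isSelfAdjoint.star_eq]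
    simpa only [hR.star_eq] using (IsSelfAdjoint.star_mul_self (1 - A)).conjugate
      (Ring.inverse (CFC.sqrt (1 + star A * A)))
  rw [gapAt1, ← csSup_lowerBounds_eq_csInf
    ⟨0, (mem_lowerBounds_spectrum_iff A 0).2 fun x => by rw [zero_mul]; positivity⟩
    (ContinuousFunctionalCalculus.spectrum_nonempty _ hsa)]
  exact congrArg sSup (Set.ext fun c => mem_lowerBounds_spectrum_iff A c)

/-- The gap depends only on the norms `‖x‖ ^ 2 + ‖A x‖ ^ 2` and `‖x - A x‖` on the graph of `A`. -/
lemma gapAt1_eq_of_surjective {A B : E →L[ℂ] E} (f : E → E) (hf : Function.Surjective f)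
    (hadd : ∀ x, ‖f x‖ ^ 2 + ‖B (f x)‖ ^ 2 = ‖x‖ ^ 2 + ‖A x‖ ^ 2)
    (hsub : ∀ x, ‖f x - B (f x)‖ ^ 2 = ‖x - A x‖ ^ 2) : gapAt1 A = gapAt1 B := by
  rcases subsingleton_or_nontrivial E with _ | _
  · rw [Subsingleton.elim A B]
  · rw [gapAt1_eq_sSup, gapAt1_eq_sSup]
    have h (c : ℝ) : (∀ y, c * (‖y‖ ^ 2 + ‖B y‖ ^ 2) ≤ ‖y - B y‖ ^ 2) ↔
        ∀ x, c * (‖x‖ ^ 2 + ‖A x‖ ^ 2) ≤ ‖x - A x‖ ^ 2 := by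
      rw [hf.forall]
      simp only [hadd, hsub]
    simp only [h]

end Gap

section OneLe

variable {A : Type*} [CStarAlgebra A] [PartialOrder A] [StarOrderedRing A]

lemma isUnit_of_one_le_star_mul_self {d : A} (h₁ : 1 ≤ star d * d) (h₂ : 1 ≤ d * star d) :
    IsUnit d := by
  obtain ⟨u, hu⟩ := CStarAlgebra.isUnit_of_le 1 h₁
  obtain ⟨v, hv⟩ := CStarAlgebra.isUnit_of_le 1 h₂
  refine isUnit_iff_exists_and_exists.2
    ⟨⟨star d * ↑v⁻¹, by rw [← mul_assoc, ← hv, Units.mul_inv]⟩,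
      ⟨↑u⁻¹ * star d, by rw [mul_assoc, ← hu, Units.inv_mul]⟩⟩

end OneLe

section Block

lemma blk_apply_fst (a b c d : H →L[ℂ] H) (x : K) : (blk a b c d x).fst = a x.fst + b x.snd := rfl

lemma blk_apply_snd (a b c d : H →L[ℂ] H) (x : K) : (blk a b c d x).snd = c x.fst + d x.snd := rfl

lemma ext_fst_snd {α β : Type*} {x y : WithLp 2 (α × β)} (h₁ : x.fst = y.fst)
    (h₂ : x.snd = y.snd) :
    x = y :=
  WithLp.ofLp_injective 2 (Prod.ext h₁ h₂)

lemma blk_eta (T : K →L[ℂ] K) : blk (blkA T) (blkB T) (blkC T) (blkD T) = T := by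
  ext1 x
  have hx : x = WithLp.toLp 2 (x.fst, 0) + WithLp.toLp 2 (0, x.snd) :=
    ext_fst_snd (by simp) (by simp)
  have hT : T x = T (WithLp.toLp 2 (x.fst, 0)) + T (WithLp.toLp 2 (0, x.snd)) := by
    rw [← map_add, ← hx]
  exact ext_fst_snd (congrArg WithLp.fst hT).symm (congrArg WithLp.snd hT).symm

lemma snd_apply_eq_blk (T : K →L[ℂ] K) (x : K) :
    (T x).snd = blkC T x.fst + blkD T x.snd := by
  conv_lhs => rw [← blk_eta T, blk_apply_snd]

lemma blk_mul (a b c d a' b' c' d' : H →L[ℂ] H) :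
    blk a b c d * blk a' b' c' d' =
      blk (a * a' + b * c') (a * b' + b * d') (c * a' + d * c') (c * b' + d * d') := by
  ext1 x
  apply ext_fst_snd <;>
  · simp only [mul_apply_eq_comp, blk_apply_fst, blk_apply_snd, add_apply, map_add]
    abel

lemma blk_inj {a b c d a' b' c' d' : H →L[ℂ] H} (h : blk a b c d = blk a' b' c' d') :
    a = a' ∧ b = b' ∧ c = c' ∧ d = d' := by
  have hfst (x : K) := congrArg WithLp.fst (DFunLike.congr_fun h x)
  have hsnd (x : K) := congrArg WithLp.snd (DFunLike.congr_fun h x)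
  simp only [blk_apply_fst] at hfst
  simp only [blk_apply_snd] at hsnd
  refine ⟨?_, ?_, ?_, ?_⟩ <;> ext x
  · simpa using hfst (WithLp.toLp 2 (x, 0))
  · simpa using hfst (WithLp.toLp 2 (0, x))
  · simpa using hsnd (WithLp.toLp 2 (x, 0))
  · simpa using hsnd (WithLp.toLp 2 (0, x))

lemma fundJ_apply_fst (x : K) : (fundJ x).fst = x.fst := by
  simp [fundJ, blk_apply_fst]

lemma fundJ_apply_snd (x : K) : (fundJ x).snd = -x.snd := by
  simp [fundJ, blk_apply_snd]

lemma fundJ_fundJ (x : K) : fundJ (fundJ x) = x :=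
  ext_fst_snd (by simp only [fundJ_apply_fst]) (by simp only [fundJ_apply_snd, neg_neg])

lemma fundJ_mul_fundJ : (fundJ : K →L[ℂ] K) * fundJ = 1 :=
  ContinuousLinearMap.ext fundJ_fundJ

lemma norm_fundJ (x : K) : ‖fundJ x‖ ^ 2 = ‖x‖ ^ 2 := by
  rw [WithLp.prod_norm_sq_eq_of_L2, WithLp.prod_norm_sq_eq_of_L2, fundJ_apply_fst,
    fundJ_apply_snd, norm_neg]

end Block

section JUnitary

lemma star_blk (a b c d : H →L[ℂ] H) :
    star (blk a b c d) = blk (star a) (star c) (star b) (star d) := by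
  symm
  rw [star_eq_adjoint (blk a b c d), ContinuousLinearMap.eq_adjoint_iff]
  intro x y
  simp only [WithLp.prod_inner_apply, WithLp.ofLp_fst, WithLp.ofLp_snd, blk_apply_fst,
    blk_apply_snd, star_eq_adjoint, inner_add_left, inner_add_right,
    ContinuousLinearMap.adjoint_inner_left]
  ring

lemma IsJUnitary.star {T : K →L[ℂ] K} (hT : IsJUnitary T) : IsJUnitary (star T) := by
  refine ⟨hT.1.star, ?_⟩
  have h : fundJ * Star.star T * fundJ * T = 1 := by
    rw [mul_assoc fundJ, mul_assoc fundJ, hT.2, fundJ_mul_fundJ]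
  have h' : T * (fundJ * Star.star T * fundJ) = 1 := by
    obtain ⟨S, hS⟩ := hT.1.exists_right_inv
    rw [left_inv_eq_right_inv h hS, hS]
  calc Star.star (Star.star T) * fundJ * Star.star T
      = T * (fundJ * Star.star T * fundJ) * fundJ := by
        simp only [star_star, mul_assoc, fundJ_mul_fundJ, mul_one]
    _ = fundJ := by rw [h', one_mul]

/-- The block relations `a*a - c*c = 1`, `a*b = c*d` and `d*d - b*b = 1`. -/
lemma isJUnitary_blk {a b c d : H →L[ℂ] H} (h : IsJUnitary (blk a b c d)) :
    star a * a - star c * c = 1 ∧ star a * b - star c * d = 0 ∧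
      star d * d - star b * b = 1 := by
  have h2 := h.2
  rw [fundJ, star_blk, blk_mul, blk_mul] at h2
  obtain ⟨h₁, h₂, -, h₄⟩ := blk_inj h2
  refine ⟨?_, ?_, ?_⟩
  · simpa [sub_eq_add_neg] using h₁
  · simpa [sub_eq_add_neg] using h₂
  · rw [← neg_inj, ← h₄]
    simp [sub_eq_add_neg]

lemma isUnit_blk {a b c d : H →L[ℂ] H} (h : IsJUnitary (blk a b c d)) :
    IsUnit a ∧ IsUnit d := by
  obtain ⟨h₁, -, h₃⟩ := isJUnitary_blk h
  have hs := h.star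
  rw [star_blk] at hs
  obtain ⟨h₁', -, h₃'⟩ := isJUnitary_blk hs
  rw [star_star, star_star] at h₁' h₃'
  constructor <;> apply isUnit_of_one_le_star_mul_self
  · rw [sub_eq_iff_eq_add.1 h₁]
    exact le_add_of_nonneg_right (star_mul_self_nonneg c)
  · rw [sub_eq_iff_eq_add.1 h₁']
    exact le_add_of_nonneg_right (mul_star_self_nonneg b)
  · rw [sub_eq_iff_eq_add.1 h₃]
    exact le_add_of_nonneg_right (star_mul_self_nonneg b)
  · rw [sub_eq_iff_eq_add.1 h₃']
    exact le_add_of_nonneg_right (mul_star_self_nonneg c)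

/-- The Schur complement of `d` in a `J`-unitary is the inverse of `a*`. -/
lemma inverse_star_eq_schur {a b c d : H →L[ℂ] H} (h : IsJUnitary (blk a b c d)) :
    Ring.inverse (star a) = a - b * Ring.inverse d * c := by
  obtain ⟨ha, hd⟩ := isUnit_blk h
  obtain ⟨h₁, h₂, -⟩ := isJUnitary_blk h
  have e : star a * (a - b * Ring.inverse d * c) = 1 := by
    rw [mul_sub, ← mul_assoc, ← mul_assoc, sub_eq_zero.1 h₂, mul_assoc (star c),
      Ring.mul_inverse_cancel d hd, mul_one, h₁]
  rw [← mul_one (Ring.inverse (star a)), ← e, ← mul_assoc,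
    Ring.inverse_mul_cancel _ ha.star, one_mul]

/-- `V(T)` exchanges the second components of `x` and `T x` on the graph of `T`. -/
lemma Vop_apply {T : K →L[ℂ] K} (hT : IsJUnitary T) (x : K) :
    Vop T (WithLp.toLp 2 (x.fst, (T x).snd)) = WithLp.toLp 2 ((T x).fst, x.snd) := by
  have hT' := hT
  rw [← blk_eta T] at hT'
  have hd := (isUnit_blk hT').2
  have hfst : (T x).fst = blkA T x.fst + blkB T x.snd := by
    conv_lhs => rw [← blk_eta T, blk_apply_fst]
  have hsnd : (T x).snd = blkC T x.fst + blkD T x.snd := snd_apply_eq_blk T x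
  have hinv (y : H) : Ring.inverse (blkD T) (blkD T y) = y :=
    DFunLike.congr_fun (Ring.inverse_mul_cancel _ hd) y
  rw [Vop, inverse_star_eq_schur hT']
  apply ext_fst_snd
  · simp only [blk_apply_fst, sub_apply, mul_apply_eq_comp, WithLp.toLp_fst, WithLp.toLp_snd,
      hfst, hsnd, map_add, hinv]
    abel
  · simp only [blk_apply_snd, neg_apply, mul_apply_eq_comp, WithLp.toLp_fst, WithLp.toLp_snd,
      hsnd, map_add, hinv]
    abel

end JUnitary

/-- Proposition 4.9 of the paper: for a `J`-unitary `T` one has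
`g(V(T)) = g(T)` and `g(T) = g(T*) = g(T⁻¹)`. -/
theorem gap_V_eq_gap (T : K →L[ℂ] K) (hT : IsJUnitary T) :
    gapAt1 (Vop T) = gapAt1 T ∧
    gapAt1 T = gapAt1 (star T) ∧
    gapAt1 T = gapAt1 (Ring.inverse T) := by
  have hsurj : Function.Surjective T := fun y =>
    ⟨Ring.inverse T y, DFunLike.congr_fun (Ring.mul_inverse_cancel T hT.1) y⟩
  refine ⟨?_, ?_, ?_⟩
  · refine (gapAt1_eq_of_surjective (fun x => WithLp.toLp 2 (x.fst, (T x).snd)) ?_ ?_ ?_).symm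
    · intro y
      have hT' := hT
      rw [← blk_eta T] at hT'
      refine ⟨WithLp.toLp 2 (y.fst, Ring.inverse (blkD T) (y.snd - blkC T y.fst)), ?_⟩
      have hinv (z : H) : blkD T (Ring.inverse (blkD T) z) = z :=
        DFunLike.congr_fun (Ring.mul_inverse_cancel _ (isUnit_blk hT').2) z
      refine ext_fst_snd rfl ?_
      simp only [snd_apply_eq_blk, WithLp.toLp_fst, WithLp.toLp_snd, hinv]
      abel
    · intro x
      rw [Vop_apply hT]
      simp only [WithLp.prod_norm_sq_eq_of_L2, WithLp.toLp_fst, WithLp.toLp_snd]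
      ring
    · intro x
      rw [Vop_apply hT]
      simp only [WithLp.prod_norm_sq_eq_of_L2, WithLp.sub_fst, WithLp.sub_snd,
        WithLp.toLp_fst, WithLp.toLp_snd]
      rw [norm_sub_rev (T x).snd]
  · have hstar (x : K) : star T (fundJ (T x)) = fundJ x := DFunLike.congr_fun hT.2 x
    refine gapAt1_eq_of_surjective (fun x => fundJ (T x)) ?_ ?_ ?_
    · exact (Function.LeftInverse.surjective fundJ_fundJ).comp hsurj
    · intro x
      rw [hstar, norm_fundJ, norm_fundJ, add_comm]
    · intro x
      rw [hstar, ← map_sub, norm_fundJ, norm_sub_rev]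
  · have hinv (x : K) : Ring.inverse T (T x) = x :=
      DFunLike.congr_fun (Ring.inverse_mul_cancel T hT.1) x
    refine gapAt1_eq_of_surjective T hsurj ?_ ?_
    · intro x
      rw [hinv, add_comm]
    · intro x
      rw [hinv, norm_sub_rev]
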